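/- A Laurent monomial u^d = u_1^{d_1}⋯u_n^{d_n}v_1^{d_{n+1}}⋯v_n^{d_{2n}} lies in R^{ℤ^n} if and only if d_{n+i} + Σ_{j=i+1}^{n}(d_j + d_{n+j}) = 0 for every i = 1,…,n; consequently R^{ℤ^n} equals the K-subalgebra of R generated by w_1^{±1},…,w_n^{±1}, where w_1 = u_1 and w_i = u_i v_{i-1}^{-1} for 2 ≤ i ≤ n. -/

import Mathlib

namespace MTW

abbrev Exp (n : ℕ) : Type := (Fin n → ℤ) × (Fin n → ℤ)

abbrev LR (K : Type) [Field K] (n : ℕ) : Type := AddMonoidAlgebra K (Exp n)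

noncomputable def mon (K : Type) [Field K] (n : ℕ) (d : Exp n) : LR K n :=
  AddMonoidAlgebra.single d 1

noncomputable def U (K : Type) [Field K] (n : ℕ) (j : Fin n) : LR K n :=
  mon K n (Pi.single j 1, 0)

noncomputable def V (K : Type) [Field K] (n : ℕ) (j : Fin n) : LR K n :=
  mon K n (0, Pi.single j 1)

noncomputable def tElt (K : Type) [Field K] (n : ℕ) (k : ℤ) (r s : Fin n → Fin n → K)
    (i : Fin n) : LR K n :=
  (r i i ^ k - s i i ^ k)⁻¹ •
    (r i i ^ k • mon K n (Pi.single i k, 0) - s i i ^ k • mon K n (0, Pi.single i k))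

noncomputable def sigmaZ (K : Type) [Field K] (n : ℕ)
    (σ : Fin n → (LR K n ≃ₐ[K] LR K n)) (g : Fin n → ℤ) : LR K n ≃ₐ[K] LR K n :=
  (List.ofFn fun i => σ i ^ (g i)).prod

def IsInvariantIdeal (K : Type) [Field K] (n : ℕ)
    (σ : Fin n → (LR K n ≃ₐ[K] LR K n)) (J : Ideal (LR K n)) : Prop :=
  ∀ (g : Fin n → ℤ), ∀ x ∈ J, sigmaZ K n σ g x ∈ J

noncomputable def invariants (K : Type) [Field K] (n : ℕ)
    (σ : Fin n → (LR K n ≃ₐ[K] LR K n)) : Subalgebra K (LR K n) :=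
  ⨅ i, AlgHom.equalizer (σ i).toAlgHom (AlgHom.id K (LR K n))

/-- Exponent vector of the invariant generator `w_i`: `w_1 = u_1` and
`w_i = u_i v_{i-1}^{-1}` for `i ≥ 2`. -/
noncomputable def wExp (n : ℕ) (i : Fin n) : Exp n :=
  (Pi.single i 1,
    if h : (i : ℕ) = 0 then 0
    else -Pi.single (⟨(i : ℕ) - 1, by have := i.isLt; omega⟩ : Fin n) 1)

/-- The additive functional `d ↦ d_{n+i} + Σ_{j>i} (d_j + d_{n+j})` giving the `σ_i`-weight of the
monomial with exponent `d`. -/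
def weight (n : ℕ) (i : Fin n) : Exp n →+ ℤ where
  toFun d := d.2 i + ∑ j ∈ Finset.univ.filter (fun j => i < j), (d.1 j + d.2 j)
  map_zero' := by simp
  map_add' d e := by
    simp only [Prod.fst_add, Prod.snd_add, Pi.add_apply, Finset.sum_add_distrib]
    ring

lemma weight_apply {n : ℕ} (i : Fin n) (d : Exp n) :
    weight n i d = d.2 i + ∑ j ∈ Finset.univ.filter (fun j => i < j), (d.1 j + d.2 j) :=
  rfl

lemma weight_single_left {n : ℕ} (i j : Fin n) :
    weight n i (Pi.single j 1, 0) = if i < j then 1 else 0 := by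
  simp [weight_apply, Pi.single_apply]

lemma weight_single_right {n : ℕ} (i j : Fin n) :
    weight n i (0, Pi.single j 1) = if i ≤ j then 1 else 0 := by
  simp only [weight_apply, Pi.single_apply, Pi.zero_apply, zero_add, Finset.sum_ite_eq',
    Finset.mem_filter, Finset.mem_univ, true_and]
  grind

lemma mon_zero (K : Type) [Field K] (n : ℕ) : mon K n 0 = 1 := rfl

lemma mon_add (K : Type) [Field K] (n : ℕ) (d e : Exp n) :
    mon K n (d + e) = mon K n d * mon K n e := by
  simp [mon, AddMonoidAlgebra.single_mul_single]

lemma exp_eq_sum {n : ℕ} (d : Exp n) :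
    d = ∑ j, d.1 j • ((Pi.single j 1, 0) : Exp n) +
      ∑ j, d.2 j • ((0, Pi.single j 1) : Exp n) := by
  ext k <;> simp [Prod.fst_sum, Prod.snd_sum, Finset.sum_apply, Pi.single_apply]

/-- An additive subgroup of `Exp n` containing the exponents of all variables is everything. -/
lemma mem_of_single_mem {n : ℕ} (S : AddSubgroup (Exp n))
    (hu : ∀ j, ((Pi.single j 1, 0) : Exp n) ∈ S) (hv : ∀ j, ((0, Pi.single j 1) : Exp n) ∈ S)
    (d : Exp n) : d ∈ S := by
  rw [exp_eq_sum d]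
  exact S.add_mem (S.sum_mem fun j _ => S.zsmul_mem (hu j) _)
    (S.sum_mem fun j _ => S.zsmul_mem (hv j) _)

/-- An algebra endomorphism scaling each variable by a power of `c` scales each monomial by the
corresponding power of `c`. -/
lemma map_mon {K : Type} [Field K] {n : ℕ} {c : K} (hc : c ≠ 0) (φ : LR K n ≃ₐ[K] LR K n)
    (w : Exp n →+ ℤ) (hu : ∀ j, φ (U K n j) = c ^ w (Pi.single j 1, 0) • U K n j)
    (hv : ∀ j, φ (V K n j) = c ^ w (0, Pi.single j 1) • V K n j) (d : Exp n) :
    φ (mon K n d) = c ^ w d • mon K n d := by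
  let S : AddSubgroup (Exp n) :=
    { carrier := {d | φ (mon K n d) = c ^ w d • mon K n d}
      zero_mem' := by simp [mon_zero]
      add_mem' := fun {a b} ha hb => by
        simp only [Set.mem_ofPred_eq] at ha hb ⊢
        rw [mon_add, map_mul, ha, hb, map_add, zpow_add₀ hc, smul_mul_smul_comm]
      neg_mem' := fun {a} ha => by
        simp only [Set.mem_ofPred_eq] at ha ⊢
        have hinv : mon K n a * mon K n (-a) = 1 := by
          rw [← mon_add, add_neg_cancel, mon_zero]
        have hscaled : φ (mon K n a) * (c ^ w (-a) • mon K n (-a)) = 1 := by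
          rw [ha, smul_mul_smul_comm, ← zpow_add₀ hc, ← map_add, add_neg_cancel, map_zero,
            zpow_zero, one_smul, hinv]
        have hmap : φ (mon K n (-a)) * φ (mon K n a) = 1 := by
          rw [mul_comm, ← map_mul, hinv, map_one]
        exact left_inv_eq_right_inv hmap hscaled }
  exact mem_of_single_mem S hu hv d

lemma zpow_eq_one_iff_of_not_root {K : Type} [Field K] {c : K}
    (hroot : ∀ m : ℕ, 0 < m → c ^ m ≠ 1) (m : ℤ) : c ^ m = 1 ↔ m = 0 := by
  refine ⟨fun h => ?_, fun h => by simp [h]⟩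
  by_contra hm
  refine hroot m.natAbs (Int.natAbs_pos.mpr hm) ?_
  rcases Int.natAbs_eq m with h' | h' <;> rw [h'] at h
  · rwa [zpow_natCast] at h
  · rwa [zpow_neg, inv_eq_one, zpow_natCast] at h

lemma weight_wExp {n : ℕ} (i j : Fin n) : weight n i (wExp n j) = 0 := by
  by_cases hj : (j : ℕ) = 0
  · have h : wExp n j = (Pi.single j 1, 0) := by simp [wExp, hj]
    rw [h, weight_single_left, if_neg]
    simp [Fin.lt_def, hj]
  · have h : wExp n j = (Pi.single j 1, 0) -
        (0, Pi.single (⟨(j : ℕ) - 1, by have := j.isLt; omega⟩ : Fin n) 1) := by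
      simp [wExp, hj]
    rw [h, map_sub, weight_single_left, weight_single_right, sub_eq_zero]
    congr 1
    simp only [Fin.lt_def, Fin.le_def, eq_iff_iff]
    omega

lemma snd_eq_of_weight_eq_zero {n : ℕ} {d : Exp n} (hd : ∀ i, weight n i d = 0) (i : Fin n) :
    d.2 i = if h : (i : ℕ) + 1 < n then -d.1 ⟨i + 1, h⟩ else 0 := by
  have hi := hd i
  rw [weight_apply] at hi
  split_ifs with h
  · have hi' := hd ⟨i + 1, h⟩
    rw [weight_apply] at hi'
    have hset : Finset.univ.filter (fun j => i < j) =
        insert (⟨i + 1, h⟩ : Fin n) (Finset.univ.filter fun j => (⟨i + 1, h⟩ : Fin n) < j) := by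
      ext j
      simp only [Finset.mem_filter, Finset.mem_univ, true_and, Finset.mem_insert, Fin.lt_def,
        Fin.ext_iff]
      omega
    rw [hset, Finset.sum_insert (by simp)] at hi
    linarith
  · have hset : Finset.univ.filter (fun j => i < j) = ∅ := by
      refine Finset.filter_eq_empty_iff.mpr fun j _ => ?_
      rw [Fin.lt_def]
      omega
    simpa [hset] using hi

lemma eq_sum_wExp {n : ℕ} {d : Exp n} (hd : ∀ i, weight n i d = 0) :
    d = ∑ j, d.1 j • wExp n j := by
  have hfst (e : Exp n) (he : e.1 = 0) (hw : ∀ i, weight n i e = 0) : e = 0 := by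
    refine Prod.ext he (funext fun i => ?_)
    rw [snd_eq_of_weight_eq_zero hw i]
    simp [he]
  refine sub_eq_zero.mp (hfst _ ?_ fun i => ?_)
  · ext k
    simp [Prod.fst_sum, wExp, Finset.sum_apply, Pi.single_apply]
  · simp only [map_sub, map_sum, map_zsmul, hd, weight_wExp, smul_zero, Finset.sum_const_zero,
      sub_zero]

lemma mon_mem_adjoin (K : Type) [Field K] {n : ℕ} {d : Exp n} (hd : ∀ i, weight n i d = 0) :
    mon K n d ∈ Algebra.adjoin K
      ((Set.range fun i => mon K n (wExp n i)) ∪ (Set.range fun i => mon K n (-wExp n i))) := by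
  set A := Algebra.adjoin K
    ((Set.range fun i => mon K n (wExp n i)) ∪ (Set.range fun i => mon K n (-wExp n i)))
  let S : AddSubgroup (Exp n) :=
    { carrier := {d | mon K n d ∈ A ∧ mon K n (-d) ∈ A}
      zero_mem' := by simp [mon_zero, A.one_mem]
      add_mem' := fun {a b} ha hb => by
        simp only [Set.mem_ofPred_eq, neg_add, mon_add]
        exact ⟨A.mul_mem ha.1 hb.1, A.mul_mem ha.2 hb.2⟩
      neg_mem' := fun {a} ha => ⟨ha.2, by rw [neg_neg]; exact ha.1⟩ }
  have hS : d ∈ S := by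
    rw [eq_sum_wExp hd]
    exact S.sum_mem fun j _ => S.zsmul_mem
      ⟨Algebra.subset_adjoin (Or.inl ⟨j, rfl⟩), Algebra.subset_adjoin (Or.inr ⟨j, rfl⟩)⟩ _
  exact hS.1

lemma mem_invariants {K : Type} [Field K] {n : ℕ} {σ : Fin n → (LR K n ≃ₐ[K] LR K n)}
    {x : LR K n} : x ∈ invariants K n σ ↔ ∀ i, σ i x = x := by
  simp [invariants, Algebra.mem_iInf, AlgHom.mem_equalizer]

/-- An algebra endomorphism which scales monomials acts on coefficients by the same scalars. -/
lemma coeff_map_of_map_mon {K : Type} [Field K] {n : ℕ} {φ : LR K n ≃ₐ[K] LR K n} {c : Exp n → K}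
    (hφ : ∀ d, φ (mon K n d) = c d • mon K n d) (x : LR K n) (d : Exp n) :
    (φ x).coeff d = c d * x.coeff d := by
  have hsum : x = ∑ e ∈ x.coeff.support, x.coeff e • mon K n e := by
    conv_lhs => rw [← AddMonoidAlgebra.sum_coeff_single x]
    simp [Finsupp.sum, mon]
  have hmap : φ x = ∑ e ∈ x.coeff.support, (c e * x.coeff e) • mon K n e := by
    conv_lhs => rw [hsum]
    simp only [map_sum, map_smul, hφ, smul_smul, mul_comm]
  rw [hmap]
  simp +contextual [mon, Finsupp.single_apply]

/-- In the quantized-Weyl-algebra setting (`r_{ij} = 1` if `j ≤ i`,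
`q_i^{-1}` if `j > i`; `s_{ij} = 1` if `j < i`, `q_i^{-1}` if `j ≥ i`): a monomial
`u^d` is invariant iff `d_{n+i} + Σ_{j>i}(d_j + d_{n+j}) = 0` for all `i`; consequently
`R^{ℤ^n}` is the `K`-subalgebra generated by `w_1^{±1},…,w_n^{±1}` with `w_1 = u_1`
and `w_i = u_i v_{i-1}^{-1}` for `2 ≤ i ≤ n`. -/
theorem statement16
    (K : Type) [Field K] (n : ℕ) (q : Fin n → K) (hq : ∀ i, q i ≠ 0)
    (hqroot : ∀ i, ∀ m : ℕ, 0 < m → q i ^ m ≠ 1)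
    (σ : Fin n → (LR K n ≃ₐ[K] LR K n))
    (hσu : ∀ i j, σ i (U K n j) = (if i < j then q i else 1) • U K n j)
    (hσv : ∀ i j, σ i (V K n j) = (if i ≤ j then q i else 1) • V K n j) :
    (∀ d : Exp n, mon K n d ∈ invariants K n σ ↔
      ∀ i : Fin n,
        d.2 i + ∑ j ∈ Finset.univ.filter (fun j => i < j), (d.1 j + d.2 j) = 0) ∧
    invariants K n σ = Algebra.adjoin K
      ((Set.range fun i => mon K n (wExp n i)) ∪
       (Set.range fun i => mon K n (-wExp n i))) := by
  have hmon (i : Fin n) (d : Exp n) : σ i (mon K n d) = q i ^ weight n i d • mon K n d := by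
    refine map_mon (hq i) (σ i) (weight n i) (fun j => ?_) (fun j => ?_) d
    · rw [hσu, weight_single_left]
      split_ifs <;> simp
    · rw [hσv, weight_single_right]
      split_ifs <;> simp
  have hsupp {x : LR K n} (hx : x ∈ invariants K n σ) {d : Exp n} (hd : x.coeff d ≠ 0)
      (i : Fin n) : weight n i d = 0 := by
    have hcoeff := coeff_map_of_map_mon (hmon i) x d
    rw [mem_invariants.mp hx i] at hcoeff
    exact (zpow_eq_one_iff_of_not_root (hqroot i) _).mp ((right_eq_mul₀ hd).mp hcoeff)
  have hinv (d : Exp n) : mon K n d ∈ invariants K n σ ↔ ∀ i, weight n i d = 0 := by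
    refine ⟨fun h => hsupp h (by simp [mon]), fun h => mem_invariants.mpr fun i => ?_⟩
    rw [hmon, h, zpow_zero, one_smul]
  refine ⟨hinv, le_antisymm (fun x hx => ?_) (Algebra.adjoin_le ?_)⟩
  · rw [← AddMonoidAlgebra.sum_coeff_single x]
    refine Subalgebra.sum_mem _ fun d hd => ?_
    have hsingle : AddMonoidAlgebra.single d (x.coeff d) = x.coeff d • mon K n d := by simp [mon]
    rw [hsingle]
    exact Subalgebra.smul_mem _ (mon_mem_adjoin K (hsupp hx (Finsupp.mem_support_iff.mp hd))) _
  · rintro _ (⟨j, rfl⟩ | ⟨j, rfl⟩)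
    · exact (hinv _).mpr fun i => weight_wExp i j
    · exact (hinv _).mpr fun i => by rw [map_neg, weight_wExp, neg_zero]

end MTW
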